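/- arXiv:1810.04235 — 3 statements merged into one kernel-verified Lean document; each statement's English description precedes it below -/
import Mathlib

section
/- Let X be a compact Hausdorff space, m ≥ 1, let U_1, …, U_m be a finite open cover of X and let h_1, …, h_m be a partition of unity subordinate to it. Let n ∈ ℕ and let ε satisfy 0 < ε < 1/(3m(n+1)). Suppose given finite index sets I_0, …, I_n, continuous functions g_i^{(k)} : X → ℝ (k = 0,…,n, i ∈ I_k) with 0 ≤ g_i^{(k)} ≤ 1 and g_i^{(k)}·g_j^{(k)} = 0 for all distinct i, j ∈ I_k, and real scalars λ_{i,r}^{(k)} ∈ [0,1] (r = 1,…,m) such that ‖h_r − Σ_{k=0}^n Σ_{i∈I_k} λ_{i,r}^{(k)} g_i^{(k)}‖∞ < ε/(m(n+1)) for every r. Define W_i^{(k)} := {x ∈ X : g_i^{(k)}(x) > 1/(m(n+1)) − ε}. Then the subfamily W := {W_i^{(k)} : there exists r with W_i^{(k)} ⊆ U_r} is a finite open cover of X, each of its members is contained in some U_r, and every point of X belongs to at most n+1 of the sets W_i^{(k)}; moreover for each fixed k the sets W_i^{(k)}, i ∈ I_k, are pairwise disjoint. -/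
open scoped Classical

/-- Given a partition of unity subordinate to a finite open cover `U` of a compact Hausdorff
space `X`, approximated within `ε/(m(n+1))` by an `(n+1)`-coloured system of pairwise
orthogonal positive functions `g`, the sets `W_i^{(k)} = {g_i^{(k)} > 1/(m(n+1)) - ε}` that are
contained in some member of `U` form a finite open refinement of `U` of order at most `n`. -/
theorem refinement_from_coloured_approximation
    {X : Type*} [TopologicalSpace X] [CompactSpace X] [T2Space X]
    (m : ℕ) (hm : 1 ≤ m) (U : Fin m → Set X) (hUopen : ∀ r, IsOpen (U r))
    (hUcover : (⋃ r, U r) = Set.univ)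
    (h : Fin m → C(X, ℝ))
    (hpos : ∀ r y, 0 ≤ h r y) (hsum : (∑ r, h r) = 1)
    (hsupp : ∀ r, closure {y | h r y ≠ 0} ⊆ U r)
    (n : ℕ) (ε : ℝ) (hε0 : 0 < ε) (hε1 : ε < 1 / (3 * m * (n + 1)))
    (I : Fin (n + 1) → Finset ℕ) (g : Fin (n + 1) → ℕ → C(X, ℝ))
    (hg0 : ∀ k, ∀ i ∈ I k, ∀ y, 0 ≤ g k i y)
    (hg1 : ∀ k, ∀ i ∈ I k, ∀ y, g k i y ≤ 1)
    (horth : ∀ k, ∀ i ∈ I k, ∀ j ∈ I k, i ≠ j → g k i * g k j = 0)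
    (lam : Fin (n + 1) → ℕ → Fin m → ℝ)
    (hlam0 : ∀ k i r, 0 ≤ lam k i r) (hlam1 : ∀ k i r, lam k i r ≤ 1)
    (happrox : ∀ r, ‖h r - ∑ k, ∑ i ∈ I k, lam k i r • g k i‖ < ε / (m * (n + 1)))
    (W : Fin (n + 1) → ℕ → Set X)
    (hW : ∀ k i, W k i = {y | 1 / (m * (n + 1)) - ε < g k i y}) :
    (∀ k, ∀ i ∈ I k, IsOpen (W k i)) ∧
    (∀ y : X, ∃ k, ∃ i ∈ I k, (∃ r, W k i ⊆ U r) ∧ y ∈ W k i) ∧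
    (∀ y : X, ((Finset.univ.sigma I).filter fun p => y ∈ W p.1 p.2).card ≤ n + 1) ∧
    (∀ k, ∀ i ∈ I k, ∀ j ∈ I k, i ≠ j → Disjoint (W k i) (W k j)) := by
  have hm' : (1:ℝ) ≤ m := by exact_mod_cast hm
  have hn' : (1:ℝ) ≤ (n:ℝ) + 1 := by
    have : (0:ℝ) ≤ n := Nat.cast_nonneg n
    linarith
  have hmpos : (0:ℝ) < m := by linarith
  have hnpos : (0:ℝ) < (n:ℝ) + 1 := by linarith
  obtain ⟨t, ht⟩ : ∃ t : ℝ, t = 1 / (m * (n + 1)) := ⟨_, rfl⟩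
  have htpos : 0 < t := by rw [ht]; positivity
  have hmt : 1 / (m:ℝ) = (n + 1) * t := by rw [ht]; field_simp
  have hε2 : 3 * ε < t := by
    have : 1 / (3 * (m:ℝ) * (n + 1)) = t / 3 := by rw [ht]; field_simp
    rw [this] at hε1; linarith
  have hεN : ε / (m * (n + 1)) = ε * t := by rw [ht]; ring
  have hmem : ∀ k i y, y ∈ W k i ↔ t - ε < g k i y := by
    intro k i y; rw [hW, ht]; rfl
  have horth' : ∀ k, ∀ i ∈ I k, ∀ j ∈ I k, i ≠ j → ∀ y, g k i y * g k j y = 0 := by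
    intro k i hi j hj hij y
    have := DFunLike.congr_fun (horth k i hi j hj hij) y
    simpa using this
  have happ : ∀ r y, |h r y - ∑ k, ∑ i ∈ I k, lam k i r * g k i y| < ε * t := by
    intro r y
    have h1 := (ContinuousMap.norm_coe_le_norm (h r - ∑ k, ∑ i ∈ I k, lam k i r • g k i) y).trans_lt
      (happrox r)
    rw [hεN] at h1
    simpa [ContinuousMap.sum_apply] using h1
  have hdisj : ∀ k, ∀ i ∈ I k, ∀ j ∈ I k, i ≠ j → ∀ y, y ∈ W k i → y ∈ W k j → False := by
    intro k i hi j hj hij y h1 h2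
    rw [hmem] at h1 h2
    have h3 := horth' k i hi j hj hij y
    have : 0 < g k i y * g k j y := mul_pos (by linarith) (by linarith)
    linarith
  refine ⟨?_, ?_, ?_, ?_⟩
  · intro k i _
    rw [hW]
    exact isOpen_lt continuous_const (g k i).continuous
  · intro y
    have hs : ∑ r, h r y = 1 := by
      have := DFunLike.congr_fun hsum y
      simpa [ContinuousMap.sum_apply] using this
    obtain ⟨r, hr⟩ : ∃ r, 1 / (m:ℝ) ≤ h r y := by
      by_contra! hc
      have : ∑ r, h r y < ∑ _r : Fin m, 1 / (m:ℝ) :=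
        Finset.sum_lt_sum_of_nonempty ⟨⟨0, hm⟩, Finset.mem_univ _⟩ (fun r _ => hc r)
      rw [hs] at this
      simp [hmpos.ne'] at this
    have h1 := (abs_lt.1 (happ r y)).2
    obtain ⟨k, hk⟩ : ∃ k, t - ε < ∑ i ∈ I k, lam k i r * g k i y := by
      by_contra! hc
      have : ∑ k, ∑ i ∈ I k, lam k i r * g k i y ≤ ∑ _k : Fin (n+1), (t - ε) :=
        Finset.sum_le_sum (fun k _ => hc k)
      simp at this
      have ht1 : t ≤ 1 := by
        rw [ht, div_le_one (by positivity)]; nlinarith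
      nlinarith
    obtain ⟨i, hi, hne⟩ : ∃ i ∈ I k, lam k i r * g k i y ≠ 0 := by
      apply Finset.exists_ne_zero_of_sum_ne_zero
      intro h0; linarith
    have hgne : g k i y ≠ 0 := right_ne_zero_of_mul hne
    rw [Finset.sum_eq_single_of_mem i hi (by
      intro j hj hji
      have := horth' k j hj i hi hji y
      rcases mul_eq_zero.1 this with h0 | h0
      · rw [h0, mul_zero]
      · exact absurd h0 hgne)] at hk
    have hgy0 := hg0 k i hi y
    have hgy1 := hg1 k i hi y
    have hl0 := hlam0 k i r
    have hl1 := hlam1 k i r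
    refine ⟨k, i, hi, ⟨r, ?_⟩, ?_⟩
    · intro z hz
      rw [hmem] at hz
      apply hsupp r
      apply subset_closure
      have hl : t - ε < lam k i r := by nlinarith
      have hterm : lam k i r * g k i z ≤ ∑ k, ∑ i ∈ I k, lam k i r * g k i z := by
        have hnn : ∀ k', ∀ j ∈ I k', 0 ≤ lam k' j r * g k' j z :=
          fun k' j hj => mul_nonneg (hlam0 _ _ _) (hg0 _ _ hj _)
        exact (Finset.single_le_sum (f := fun i => lam k i r * g k i z) (hnn k) hi).trans
          (Finset.single_le_sum (f := fun k => ∑ i ∈ I k, lam k i r * g k i z)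
            (fun k' _ => Finset.sum_nonneg (hnn k')) (Finset.mem_univ k))
      have hz1 := (abs_lt.1 (happ r z)).1
      have hsq : (t - ε) * (t - ε) < lam k i r * g k i z :=
        mul_lt_mul'' hl hz (by linarith) (by linarith)
      have : 0 < h r z := by nlinarith
      exact this.ne'
    · rw [hmem]; nlinarith
  · intro y
    have := Finset.card_le_card_of_injOn (s := (Finset.univ.sigma I).filter fun p => y ∈ W p.1 p.2)
      (t := (Finset.univ : Finset (Fin (n+1)))) (fun p => p.1) (fun _ _ => Finset.mem_univ _) (by
        rintro ⟨k, i⟩ hp ⟨k', j⟩ hq hkk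
        simp at hp hq hkk
        subst hkk
        by_contra hne
        exact hdisj k i hp.1 j hq.1 (fun e => hne (by rw [e])) y hp.2 hq.2)
    simpa using this
  · intro k i hi j hj hij
    rw [Set.disjoint_left]
    exact fun y h1 h2 => hdisj k i hi j hj hij y h1 h2
end

section
/- Let X be a compact Hausdorff space and n ∈ ℕ. Suppose that for every m ≥ 1, every family of continuous functions h_1, …, h_m : X → ℝ with each h_r nonnegative and Σ_{r=1}^m h_r = 1, and every δ > 0, there exist finite index sets I_0, …, I_n, continuous functions g_i^{(k)} : X → ℝ (k = 0,…,n, i ∈ I_k) with 0 ≤ g_i^{(k)} ≤ 1 and g_i^{(k)}·g_j^{(k)} = 0 for distinct i, j ∈ I_k, and scalars λ_{i,r}^{(k)} ∈ [0,1] with ‖h_r − Σ_{k,i} λ_{i,r}^{(k)} g_i^{(k)}‖∞ < δ for every r. Then every finite open cover of X admits a finite open refinement of order at most n, i.e. a finite open cover of X each of whose members is contained in some member of the original cover and such that every point of X belongs to at most n+1 of its members. -/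
open scoped Classical

/-- If every finite partition of unity on the compact Hausdorff space `X` can be approximated
arbitrarily well by `(n+1)`-coloured systems of pairwise orthogonal positive functions, then
every finite open cover of `X` admits a finite open refinement of order at most `n`,
i.e. `dim X ≤ n`. -/
theorem covering_dimension_le_of_coloured_approximations
    {X : Type*} [TopologicalSpace X] [CompactSpace X] [T2Space X] (n : ℕ)
    (H : ∀ (m : ℕ), 1 ≤ m → ∀ (h : Fin m → C(X, ℝ)),
      (∀ r y, 0 ≤ h r y) → (∑ r, h r) = 1 → ∀ δ : ℝ, 0 < δ →
      ∃ (I : Fin (n + 1) → Finset ℕ) (g : Fin (n + 1) → ℕ → C(X, ℝ))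
        (lam : Fin (n + 1) → ℕ → Fin m → ℝ),
        (∀ k, ∀ i ∈ I k, ∀ y, 0 ≤ g k i y) ∧
        (∀ k, ∀ i ∈ I k, ∀ y, g k i y ≤ 1) ∧
        (∀ k, ∀ i ∈ I k, ∀ j ∈ I k, i ≠ j → g k i * g k j = 0) ∧
        (∀ k i r, 0 ≤ lam k i r ∧ lam k i r ≤ 1) ∧
        (∀ r, ‖h r - ∑ k, ∑ i ∈ I k, lam k i r • g k i‖ < δ)) :
    ∀ (ι : Type) (U : ι → Set X), Finite ι → (∀ i, IsOpen (U i)) →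
      (⋃ i, U i) = Set.univ →
      ∃ (J : Type) (_ : Fintype J) (V : J → Set X),
        (∀ j, IsOpen (V j)) ∧ (⋃ j, V j) = Set.univ ∧
        (∀ j, ∃ i, V j ⊆ U i) ∧
        ∀ y : X, Set.ncard {j | y ∈ V j} ≤ n + 1 := by
  intro ι U hfin hU hcov
  rcases isEmpty_or_nonempty X with hX | hX
  · refine ⟨Empty, inferInstance, fun j => j.elim, fun j => j.elim, ?_, fun j => j.elim, ?_⟩
    · ext y; exact hX.elim y
    · intro y; exact hX.elim y
  have hιne : Nonempty ι := by
    obtain ⟨y⟩ := hX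
    have : y ∈ ⋃ i, U i := by rw [hcov]; trivial
    obtain ⟨i, _⟩ := Set.mem_iUnion.1 this
    exact ⟨i⟩
  obtain ⟨m, ⟨e⟩⟩ := Finite.exists_equiv_fin ι
  have hm : 1 ≤ m := by
    obtain ⟨i⟩ := hιne
    have := (e i).2
    omega
  have hne : Nonempty (Fin m) := ⟨⟨0, hm⟩⟩
  obtain ⟨f, hf⟩ := PartitionOfUnity.exists_isSubordinate (s := (Set.univ : Set X)) isClosed_univ
    (fun r : Fin m => U (e.symm r)) (fun r => hU _) (by
      intro y _
      have : y ∈ ⋃ i, U i := by rw [hcov]; trivial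
      obtain ⟨i, hi⟩ := Set.mem_iUnion.1 this
      exact Set.mem_iUnion.2 ⟨e i, by simpa using hi⟩)
  have hsum : ∀ y, ∑ r, f r y = 1 := by
    intro y
    rw [← finsum_eq_sum_of_fintype]
    exact f.sum_eq_one (Set.mem_univ y)
  have hsub : ∀ r y, 0 < f r y → y ∈ U (e.symm r) := by
    intro r y hy
    exact hf r (subset_tsupport _ (by simpa using hy.ne'))
  have hmpos : (0 : ℝ) < m := by exact_mod_cast hm
  obtain ⟨c, hc⟩ : ∃ c : ℝ, c = 1 / (2 * (n + 1)) := ⟨_, rfl⟩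
  have hcpos : 0 < c := by rw [hc]; positivity
  have hc1 : (n + 1) * c = 1 / 2 := by rw [hc]; field_simp
  have hcle : c ≤ 1 / 2 := by
    have : (0 : ℝ) ≤ n * c := by positivity
    linarith
  obtain ⟨δ, hδ⟩ : ∃ δ : ℝ, δ = c / (2 * m) := ⟨_, rfl⟩
  have hδpos : 0 < δ := by rw [hδ]; positivity
  have hmδ : m * δ = c / 2 := by rw [hδ]; field_simp
  obtain ⟨I, g, lam, hg0, hg1, horth, hlam, happ⟩ := H m hm (fun r => f r)
    (fun r y => f.nonneg r y) (by ext y; simpa using hsum y) δ hδpos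
  have happ' : ∀ r y, |f r y - ∑ k, ∑ i ∈ I k, lam k i r * g k i y| < δ := by
    intro r y
    have h1 := lt_of_le_of_lt (ContinuousMap.norm_coe_le_norm _ y) (happ r)
    simpa [ContinuousMap.sum_apply, Real.norm_eq_abs] using h1
  refine ⟨Σ k : Fin (n + 1), I k, inferInstance,
    fun j => {y | c < (∑ r, lam j.1 j.2 r) * g j.1 j.2 y}, ?_, ?_, ?_, ?_⟩
  · intro j
    exact isOpen_lt continuous_const (by fun_prop)
  · rw [Set.eq_univ_iff_forall]
    intro y
    by_contra hy
    simp only [Set.mem_iUnion, Set.mem_setOf_eq, not_exists, not_lt] at hy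
    have hk : ∀ k, ∑ i ∈ I k, (∑ r, lam k i r) * g k i y ≤ c := by
      intro k
      by_cases h0 : ∃ i ∈ I k, g k i y ≠ 0
      · obtain ⟨i, hi, hne0⟩ := h0
        rw [Finset.sum_eq_single_of_mem i hi]
        · exact hy ⟨k, i, hi⟩
        · intro j hj hji
          have := congrArg (fun F : C(X, ℝ) => F y) (horth k j hj i hi hji)
          simp only [ContinuousMap.mul_apply, ContinuousMap.zero_apply, mul_eq_zero] at this
          rw [this.resolve_right hne0, mul_zero]
      · push Not at h0
        rw [Finset.sum_eq_zero]
        · exact hcpos.le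
        · intro i hi
          rw [h0 i hi, mul_zero]
    have htot : ∑ k, ∑ i ∈ I k, (∑ r, lam k i r) * g k i y ≤ (n + 1) * c := by
      calc _ ≤ ∑ k : Fin (n + 1), c := Finset.sum_le_sum fun k _ => hk k
        _ = _ := by simp
    have hswap : ∑ k, ∑ i ∈ I k, (∑ r, lam k i r) * g k i y
        = ∑ r, ∑ k, ∑ i ∈ I k, lam k i r * g k i y := by
      rw [Finset.sum_comm]
      refine Finset.sum_congr rfl fun k _ => ?_
      rw [Finset.sum_comm]
      exact Finset.sum_congr rfl fun i _ => Finset.sum_mul _ _ _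
    have h2 : ∑ r, f r y ≤ ∑ r, (∑ k, ∑ i ∈ I k, lam k i r * g k i y + δ) :=
      Finset.sum_le_sum fun r _ => by
        have := (abs_lt.1 (happ' r y)).2
        linarith
    rw [hsum, Finset.sum_add_distrib, ← hswap] at h2
    simp only [Finset.sum_const, Finset.card_univ, Fintype.card_fin, nsmul_eq_mul] at h2
    linarith
  · rintro ⟨k, i, hi⟩
    obtain ⟨r, hr⟩ := Finite.exists_max (lam k i)
    refine ⟨e.symm r, fun y hy => hsub r y ?_⟩
    simp only [Set.mem_setOf_eq] at hy
    have h1 : ∑ r, lam k i r ≤ m * lam k i r := by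
      calc _ ≤ ∑ _r : Fin m, lam k i r := Finset.sum_le_sum fun s _ => hr s
        _ = _ := by simp
    have h2 := mul_le_mul_of_nonneg_right h1 (hg0 k i hi y)
    have h3 : lam k i r * g k i y ≤ ∑ k, ∑ i ∈ I k, lam k i r * g k i y := by
      calc _ ≤ ∑ i ∈ I k, lam k i r * g k i y :=
            Finset.single_le_sum (f := fun i => lam k i r * g k i y)
              (fun j hj => mul_nonneg (hlam k j r).1 (hg0 k j hj y)) hi
        _ ≤ _ := Finset.single_le_sum (f := fun k => ∑ i ∈ I k, lam k i r * g k i y)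
              (fun l _ => Finset.sum_nonneg fun j hj =>
                mul_nonneg (hlam l j r).1 (hg0 l j hj y)) (Finset.mem_univ k)
    have h4 := (abs_lt.1 (happ' r y)).1
    have h5 : δ < lam k i r * g k i y := by
      refine lt_of_mul_lt_mul_left ?_ hmpos.le
      rw [hmδ]
      linarith
    linarith
  · intro y
    have key := Set.ncard_le_ncard_of_injOn
      (s := {j : Σ k : Fin (n + 1), I k | y ∈ {y | c < (∑ r, lam j.1 j.2 r) * g j.1 j.2 y}})
      (t := (Set.univ : Set (Fin (n + 1)))) (fun j => j.1) (fun _ _ => Set.mem_univ _) (by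
        rintro ⟨k, i, hi⟩ h1 ⟨k', j, hj⟩ h2 hkk
        simp only at hkk
        subst hkk
        simp only [Set.mem_setOf_eq] at h1 h2
        by_contra hne'
        have hij : i ≠ j := by
          rintro rfl
          exact hne' rfl
        have := congrArg (fun F : C(X, ℝ) => F y) (horth k i hi j hj hij)
        simp only [ContinuousMap.mul_apply, ContinuousMap.zero_apply, mul_eq_zero] at this
        rcases this with h | h
        · rw [h, mul_zero] at h1
          linarith
        · rw [h, mul_zero] at h2
          linarith) Set.finite_univ
    simpa [Set.ncard_univ] using key
end

section
/- Let H be a separable complex Hilbert space with Hilbert (orthonormal) basis (e_i)_{i∈ℕ}, and for n ∈ ℕ let P_n : H → H be the orthogonal projection onto the span of e_0, …, e_{n−1}. Then for every compact operator T : H → H and every ε > 0 there exists N ∈ ℕ such that ‖T − P_n T P_n‖ < ε for all n ≥ N, where ‖·‖ is the operator norm. (Hence the union of the corners P_n K(H) P_n is dense in the compact operators K(H), showing that K(H) is approximately finite dimensional.) -/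
/-- The orthogonal projection of a Hilbert space `H` onto the span of the first `n` vectors
`e 0, …, e (n-1)` of a Hilbert basis `e`, given by `x ↦ ∑_{i < n} ⟪e i, x⟫ • e i`. -/
noncomputable def truncProj {H : Type*} [NormedAddCommGroup H] [InnerProductSpace ℂ H]
    [CompleteSpace H] (e : HilbertBasis ℕ ℂ H) (n : ℕ) : H →L[ℂ] H :=
  ∑ i ∈ Finset.range n, (innerSL ℂ (e i)).smulRight (e i)

open Filter Topology in
theorem truncProj_apply {H : Type*} [NormedAddCommGroup H] [InnerProductSpace ℂ H]
    [CompleteSpace H] (e : HilbertBasis ℕ ℂ H) (n : ℕ) (x : H) :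
    truncProj e n x = ∑ i ∈ Finset.range n, inner ℂ (e i) x • e i := by
  simp [truncProj]

open Filter Topology in
theorem truncProj_tendsto {H : Type*} [NormedAddCommGroup H] [InnerProductSpace ℂ H]
    [CompleteSpace H] (e : HilbertBasis ℕ ℂ H) (x : H) :
    Tendsto (fun n => truncProj e n x) atTop (𝓝 x) := by
  have h := (e.hasSum_repr x).tendsto_sum_nat
  simpa only [truncProj_apply, e.repr_apply_apply] using h

theorem truncProj_adjoint {H : Type*} [NormedAddCommGroup H] [InnerProductSpace ℂ H]
    [CompleteSpace H] (e : HilbertBasis ℕ ℂ H) (n : ℕ) :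
    ContinuousLinearMap.adjoint (truncProj e n) = truncProj e n := by
  symm
  rw [ContinuousLinearMap.eq_adjoint_iff]
  intro x y
  simp only [truncProj_apply, sum_inner, inner_sum, inner_smul_left, inner_smul_right,
    inner_conj_symm]
  exact Finset.sum_congr rfl fun i _ => mul_comm _ _

theorem truncProj_norm_le {H : Type*} [NormedAddCommGroup H] [InnerProductSpace ℂ H]
    [CompleteSpace H] (e : HilbertBasis ℕ ℂ H) (n : ℕ) : ‖truncProj e n‖ ≤ 1 := by
  apply IsStarProjection.norm_le
  refine ⟨?_, truncProj_adjoint e n⟩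
  ext x
  change truncProj e n (truncProj e n x) = truncProj e n x
  rw [truncProj_apply e n (truncProj e n x), truncProj_apply e n x]
  refine Finset.sum_congr rfl fun i hi => ?_
  rw [e.orthonormal.inner_right_sum _ hi]

theorem truncProj_compact {H : Type*} [NormedAddCommGroup H] [InnerProductSpace ℂ H]
    [CompleteSpace H] (e : HilbertBasis ℕ ℂ H) (n : ℕ) : IsCompactOperator (truncProj e n) := by
  change truncProj e n ∈ compactOperator (RingHom.id ℂ) H H
  refine Submodule.sum_mem _ fun i _ => ?_
  change IsCompactOperator ((innerSL ℂ (e i)).smulRight (e i))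
  have h : IsCompactOperator (innerSL ℂ (e i)) :=
    isCompactOperator_of_locallyCompactSpace_dom (innerSL ℂ (e i))
  exact h.continuous_comp (g := fun c : ℂ => c • e i) (by fun_prop)

open Filter Topology in
theorem truncProj_comp_tendsto {H : Type*} [NormedAddCommGroup H] [InnerProductSpace ℂ H]
    [CompleteSpace H] (e : HilbertBasis ℕ ℂ H) (T : H →L[ℂ] H) (hT : IsCompactOperator T) :
    Tendsto (fun n => (truncProj e n).comp T) atTop (𝓝 T) := by
  rw [Metric.tendsto_atTop]
  intro ε hε
  have hK := (IsCompactOperator.isCompact_closure_image_closedBall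
    (f := (T : H →ₗ[ℂ] H)) hT 1).totallyBounded
  obtain ⟨t, ht, hcov⟩ := Metric.totallyBounded_iff.1 hK (ε / 4) (by positivity)
  have hev : ∀ᶠ n in atTop, ∀ y ∈ t, dist (truncProj e n y) y < ε / 4 :=
    (eventually_all_finite ht).2 fun y _ =>
      (Metric.tendsto_nhds.1 (truncProj_tendsto e y)) _ (by positivity)
  obtain ⟨N, hN⟩ := eventually_atTop.1 hev
  refine ⟨N, fun n hn => ?_⟩
  rw [dist_eq_norm]
  refine lt_of_le_of_lt (b := 3 * ε / 4) ?_ (by linarith)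
  refine ContinuousLinearMap.opNorm_le_of_unit_norm (by positivity) fun x hx => ?_
  have hmem : T x ∈ closure ((T : H →ₗ[ℂ] H) '' Metric.closedBall 0 1) :=
    subset_closure ⟨x, by simp [hx], rfl⟩
  obtain ⟨y, hy, hxy⟩ := Set.mem_iUnion₂.1 (hcov hmem)
  rw [Metric.mem_ball, dist_eq_norm] at hxy
  have h1 := hN n hn y hy
  rw [dist_eq_norm] at h1
  have h2 : ‖truncProj e n (T x - y)‖ ≤ ‖T x - y‖ := by
    simpa using (truncProj e n).le_of_opNorm_le (truncProj_norm_le e n) (T x - y)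
  have h3 : ((truncProj e n).comp T - T) x
      = truncProj e n (T x - y) + (truncProj e n y - y) - (T x - y) := by
    simp
  rw [h3]
  have h4 := norm_sub_le (truncProj e n (T x - y) + (truncProj e n y - y)) (T x - y)
  have h5 := norm_add_le (truncProj e n (T x - y)) (truncProj e n y - y)
  linarith

open Filter Topology in
theorem comp_truncProj_tendsto {H : Type*} [NormedAddCommGroup H] [InnerProductSpace ℂ H]
    [CompleteSpace H] (e : HilbertBasis ℕ ℂ H) (T : H →L[ℂ] H) (hT : IsCompactOperator T) :
    Tendsto (fun n => T.comp (truncProj e n)) atTop (𝓝 T) := by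
  have hc : Continuous (fun A : H →L[ℂ] H => ContinuousLinearMap.adjoint A) :=
    (ContinuousLinearMap.adjoint (𝕜 := ℂ) (E := H) (F := H)).continuous
  have h1 := (hc.tendsto T).comp (truncProj_comp_tendsto e T hT)
  have hS : IsCompactOperator (ContinuousLinearMap.adjoint T) := by
    refine isCompactOperator_of_tendsto h1 (Eventually.of_forall fun n => ?_)
    simp only [Function.comp, ContinuousLinearMap.adjoint_comp, truncProj_adjoint]
    exact (truncProj_compact e n).clm_comp (ContinuousLinearMap.adjoint T)
  have h2 := (hc.tendsto _).comp (truncProj_comp_tendsto e _ hS)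
  simpa only [Function.comp_def, ContinuousLinearMap.adjoint_comp, truncProj_adjoint,
    ContinuousLinearMap.adjoint_adjoint] using h2

/-- For every compact operator `T` on a separable Hilbert space with Hilbert basis
`(e_i)_{i ∈ ℕ}` and every `ε > 0`, the compressions `P_n T P_n` to the spans of
`e_0, …, e_{n-1}` eventually approximate `T` within `ε` in operator norm.  Hence the union of
the corners `P_n K(H) P_n` is dense in `K(H)`, so `K(H)` is approximately finite dimensional. -/
theorem compact_operator_approximated_by_corners
    {H : Type*} [NormedAddCommGroup H] [InnerProductSpace ℂ H] [CompleteSpace H]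
    (e : HilbertBasis ℕ ℂ H) (T : H →L[ℂ] H) (hT : IsCompactOperator T)
    (ε : ℝ) (hε : 0 < ε) :
    ∃ N : ℕ, ∀ n ≥ N, ‖T - (truncProj e n).comp (T.comp (truncProj e n))‖ < ε := by
  have h1 := (Metric.tendsto_atTop.1 (truncProj_comp_tendsto e T hT)) (ε / 2) (by positivity)
  have h2 := (Metric.tendsto_atTop.1 (comp_truncProj_tendsto e T hT)) (ε / 2) (by positivity)
  obtain ⟨N1, h1⟩ := h1
  obtain ⟨N2, h2⟩ := h2
  refine ⟨max N1 N2, fun n hn => ?_⟩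
  have a1 := h1 n (le_trans (le_max_left _ _) hn)
  have a2 := h2 n (le_trans (le_max_right _ _) hn)
  rw [dist_comm, dist_eq_norm] at a1 a2
  have h3 : T - (truncProj e n).comp (T.comp (truncProj e n))
      = (T - (truncProj e n).comp T) + (truncProj e n).comp (T - T.comp (truncProj e n)) := by
    ext x
    simp
  rw [h3]
  have h4 := norm_add_le (T - (truncProj e n).comp T)
    ((truncProj e n).comp (T - T.comp (truncProj e n)))
  have h5 := (truncProj e n).opNorm_comp_le (T - T.comp (truncProj e n))
  have h6 := mul_le_mul_of_nonneg_right (truncProj_norm_le e n)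
    (norm_nonneg (T - T.comp (truncProj e n)))
  linarith
end
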